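/- For every integer l and all real s, r, the Pfaffian tau functions satisfy the bilinear equation ((D_s - b)³ - (D_r - b³)) τ_{l+1}·τ_l = 0, i.e. D_s³ τ_{l+1}·τ_l - 3b D_s² τ_{l+1}·τ_l + 3b² D_s τ_{l+1}·τ_l - D_r τ_{l+1}·τ_l = 0, where all D_s operators act in the variable s and D_r a·b = a_r b - a b_r. (Lemma 3.1 of the paper.) -/

import Mathlib

/-- The Pfaffian of a `2n × 2n` real matrix,
`Pf(B) = (1/(2^n n!)) Σ_{σ∈S_{2n}} sgn(σ) Π_{k=1}^n B_{σ(2k-1),σ(2k)}`. -/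
noncomputable def pfaffian (n : ℕ) (B : Matrix (Fin (2*n)) (Fin (2*n)) ℝ) : ℝ :=
  (1 / (2^n * (Nat.factorial n : ℝ))) *
    ∑ σ : Equiv.Perm (Fin (2*n)), ((Equiv.Perm.sign σ : ℤ) : ℝ) *
      ∏ k : Fin n, B (σ ⟨2*(k:ℕ), by have := k.isLt; omega⟩)
        (σ ⟨2*(k:ℕ)+1, by have := k.isLt; omega⟩)

/-- Partial derivative in the first variable `s` of a function of `(s, r)`. -/
noncomputable def dS (f : ℝ → ℝ → ℝ) : ℝ → ℝ → ℝ := fun s r => deriv (fun t => f t r) s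

/-- Partial derivative in the second variable `r` of a function of `(s, r)`. -/
noncomputable def dR (f : ℝ → ℝ → ℝ) : ℝ → ℝ → ℝ := fun s r => deriv (fun t => f s t) r
open Matrix in
theorem pf_cov (n : ℕ) (S B : Matrix (Fin (2*n)) (Fin (2*n)) ℝ) :
    pfaffian n (S * B * Sᵀ) = S.det * pfaffian n B := by
  classical
  let i0 : Fin n → Fin (2*n) := fun k => ⟨2*(k:ℕ), by have := k.isLt; omega⟩
  let i1 : Fin n → Fin (2*n) := fun k => ⟨2*(k:ℕ)+1, by have := k.isLt; omega⟩
  let e : Fin n × Fin 2 ≃ Fin (2*n) := finProdFinEquiv.trans (finCongr (mul_comm n 2))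
  have e0 : ∀ k, e (k, 0) = i0 k := by
    intro k; ext; simp [e, i0, finProdFinEquiv]
  have e1 : ∀ k, e (k, 1) = i1 k := by
    intro k; ext; simp [e, i1, finProdFinEquiv]; ring
  have hprod : ∀ g : Fin (2*n) → ℝ, ∏ m, g m = ∏ k, (g (i0 k) * g (i1 k)) := by
    intro g
    rw [← e.prod_comp, Fintype.prod_prod_type]
    simp [Fin.prod_univ_two, e0, e1]
  let E : (Fin (2*n) → Fin (2*n)) ≃ (Fin n → Fin (2*n) × Fin (2*n)) :=
    { toFun := fun f k => (f (i0 k), f (i1 k))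
      invFun := fun g m => if (e.symm m).2 = 0 then (g (e.symm m).1).1 else (g (e.symm m).1).2
      left_inv := by
        intro f; funext m
        obtain ⟨⟨k, j⟩, rfl⟩ := e.surjective m
        fin_cases j <;> simp [← e0, ← e1]
      right_inv := by
        intro g; funext k
        simp [← e0, ← e1] }
  have hexp : ∀ σ : Equiv.Perm (Fin (2*n)),
      ∏ k, (S * B * Sᵀ) (σ (i0 k)) (σ (i1 k))
      = ∑ f : Fin (2*n) → Fin (2*n), (∏ m, S (σ m) (f m)) * ∏ k, B (f (i0 k)) (f (i1 k)) := by
    intro σ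
    have h1 : ∀ k, (S * B * Sᵀ) (σ (i0 k)) (σ (i1 k)) =
        ∑ ab : Fin (2*n) × Fin (2*n), S (σ (i0 k)) ab.1 * S (σ (i1 k)) ab.2 * B ab.1 ab.2 := by
      intro k
      rw [Matrix.mul_apply, Fintype.sum_prod_type_right]
      refine Finset.sum_congr rfl fun b _ => ?_
      rw [Matrix.mul_apply, Finset.sum_mul]
      refine Finset.sum_congr rfl fun a _ => ?_
      rw [Matrix.transpose_apply]; ring
    simp_rw [h1]
    rw [Finset.prod_univ_sum, Fintype.piFinset_univ, ← E.sum_comp]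
    refine Finset.sum_congr rfl fun f _ => ?_
    rw [hprod, ← Finset.prod_mul_distrib]; rfl
  have key : ∑ σ : Equiv.Perm (Fin (2*n)), ((Equiv.Perm.sign σ : ℤ) : ℝ) *
      ∏ k, (S * B * Sᵀ) (σ (i0 k)) (σ (i1 k)) =
      S.det * ∑ σ : Equiv.Perm (Fin (2*n)), ((Equiv.Perm.sign σ : ℤ) : ℝ) *
      ∏ k, B (σ (i0 k)) (σ (i1 k)) := by
    simp_rw [hexp, Finset.mul_sum]
    rw [Finset.sum_comm]
    have h2 : ∀ f : Fin (2*n) → Fin (2*n),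
        ∑ σ : Equiv.Perm (Fin (2*n)), ((Equiv.Perm.sign σ : ℤ) : ℝ) *
          ((∏ m, S (σ m) (f m)) * ∏ k, B (f (i0 k)) (f (i1 k)))
        = (S.submatrix id f).det * ∏ k, B (f (i0 k)) (f (i1 k)) := by
      intro f
      rw [Matrix.det_apply', Finset.sum_mul]
      refine Finset.sum_congr rfl fun σ _ => ?_
      simp [mul_assoc]
    simp_rw [h2]
    symm
    refine Finset.sum_of_injOn (fun σ : Equiv.Perm (Fin (2*n)) => (σ : Fin (2*n) → Fin (2*n)))
      ?_ ?_ ?_ ?_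
    · intro a _ b _ h; exact DFunLike.coe_injective h
    · intro a _; simp
    · intro f _ hf
      have : ¬ Function.Injective f := by
        intro hi
        apply hf
        refine ⟨Equiv.ofBijective f (Finite.injective_iff_bijective.mp hi), by simp, rfl⟩
      simp only [Function.Injective] at this
      push Not at this
      obtain ⟨a, b, hab, hne⟩ := this
      rw [Matrix.det_zero_of_column_eq hne (by intro i; simp [hab]), zero_mul]
    · intro σ _
      rw [Matrix.det_permute']
      ring
  unfold pfaffian
  rw [mul_left_comm, ← key]

open Matrix in
theorem pf_rank2 (n : ℕ) (A : Matrix (Fin (2*n)) (Fin (2*n)) ℝ) (hA : Aᵀ = -A)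
    (hdet : A.det ≠ 0) (x y : Fin (2*n) → ℝ) :
    pfaffian n (A + (vecMulVec x y - vecMulVec y x)) = (1 - x ⬝ᵥ A⁻¹ *ᵥ y) * pfaffian n A := by
  have hu : IsUnit A.det := isUnit_iff_ne_zero.mpr hdet
  set w := A⁻¹ *ᵥ y with hw
  have hAw : A *ᵥ w = y := by rw [hw, mulVec_mulVec, mul_nonsing_inv _ hu, one_mulVec]
  have hwA : w ᵥ* A = -y := by
    rw [← mulVec_transpose, hA, neg_mulVec, hAw]
  have hS : (1 - vecMulVec x w) * A * (1 - vecMulVec x w)ᵀ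
      = A + (vecMulVec x y - vecMulVec y x) := by
    have hww : w ⬝ᵥ y = 0 := by
      have h1 : w ⬝ᵥ A *ᵥ w = (w ᵥ* A) ⬝ᵥ w := dotProduct_mulVec _ _ _
      rw [hAw, hwA, neg_dotProduct, dotProduct_comm y w] at h1
      linarith
    rw [transpose_sub, transpose_one, transpose_vecMulVec, sub_mul, one_mul, vecMulVec_mul, hwA,
      mul_sub, mul_one, sub_mul, mul_vecMulVec, hAw, vecMulVec_mul_vecMulVec]
    rw [neg_dotProduct, dotProduct_comm, hww]
    simp [vecMulVec_neg]
    abel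
  have hdS : (1 - vecMulVec x w).det = 1 - x ⬝ᵥ w := by
    rw [vecMulVec_eq Unit, sub_eq_add_neg, ← Matrix.neg_mul, det_one_add_mul_comm]
    simp [det_unique, dotProduct_comm]
    ring
  rw [← hS, pf_cov, hdS]

theorem pf_smooth (n : ℕ) {E : Type*} [NormedAddCommGroup E] [NormedSpace ℝ E]
    (M : E → Matrix (Fin (2*n)) (Fin (2*n)) ℝ) {k : WithTop ℕ∞}
    (hM : ∀ i j, ContDiff ℝ k (fun e => M e i j)) :
    ContDiff ℝ k (fun e => pfaffian n (M e)) := by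
  unfold pfaffian
  refine contDiff_const.mul (ContDiff.sum fun σ _ => contDiff_const.mul
    (contDiff_prod fun i _ => hM _ _))

/-- wedge of two vectors as a skew matrix. -/
def wdg {m : ℕ} (x y : Fin m → ℝ) : Matrix (Fin m) (Fin m) ℝ :=
  Matrix.vecMulVec x y - Matrix.vecMulVec y x

/-- the bilinear form of the inverse matrix. -/
noncomputable def gg {m : ℕ} (A : Matrix (Fin m) (Fin m) ℝ) (x y : Fin m → ℝ) : ℝ :=
  x ⬝ᵥ (A⁻¹).mulVec y

open Matrix in
theorem gg_skew {m : ℕ} (A : Matrix (Fin m) (Fin m) ℝ) (hA : Aᵀ = -A) (x y : Fin m → ℝ) :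
    gg A x y = - gg A y x := by
  unfold gg
  have h : (A⁻¹)ᵀ = - A⁻¹ := by
    rw [transpose_nonsing_inv, hA]
    by_cases hu : IsUnit A.det
    · refine inv_eq_right_inv ?_
      rw [neg_mul_neg, mul_nonsing_inv _ hu]
    · rw [nonsing_inv_apply_not_isUnit _ hu, nonsing_inv_apply_not_isUnit, neg_zero]
      rw [det_neg]
      intro h; exact hu (isUnit_of_mul_isUnit_right h)
  rw [dotProduct_mulVec, ← mulVec_transpose, h, neg_mulVec, neg_dotProduct, dotProduct_comm]

/-- a matrix as a plain function of two indices. -/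
def mf {m : ℕ} (A : Matrix (Fin m) (Fin m) ℝ) : Fin m → Fin m → ℝ := fun i j => A i j

/-- the Pfaffian of a plain function of two indices. -/
noncomputable def pfF (n : ℕ) (B : Fin (2*n) → Fin (2*n) → ℝ) : ℝ := pfaffian n (Matrix.of B)

theorem pfF_diff (n : ℕ) : Differentiable ℝ (pfF n) := by
  have hs : ContDiff ℝ 1 (pfF n) := by
    unfold pfF
    apply pf_smooth
    intro i j
    simp only [Matrix.of_apply]
    fun_prop
  exact hs.differentiable one_ne_zero

theorem pf_fderiv (n : ℕ) (A : Matrix (Fin (2*n)) (Fin (2*n)) ℝ) (hA : A.transpose = -A)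
    (hdet : A.det ≠ 0) (x y : Fin (2*n) → ℝ) :
    fderiv ℝ (pfF n) (mf A) (mf (wdg x y)) = - gg A x y * pfaffian n A := by
  have hl : HasDerivAt (fun t : ℝ => mf A + t • mf (wdg x y)) (mf (wdg x y)) 0 := by
    simpa using ((hasDerivAt_id (0:ℝ)).smul_const (mf (wdg x y))).const_add (mf A)
  have h1 := HasFDerivAt.comp_hasDerivAt (0:ℝ) (l := pfF n) (l' := fderiv ℝ (pfF n) (mf A))
    (by simpa using (pfF_diff n (mf A)).hasFDerivAt) hl
  have h2 : HasDerivAt (fun t : ℝ => (1 - t * gg A x y) * pfaffian n A)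
      (- gg A x y * pfaffian n A) 0 := by
    simpa using (((hasDerivAt_id (0:ℝ)).mul_const (gg A x y)).const_sub 1).mul_const (pfaffian n A)
  refine h1.unique (h2.congr_of_eventuallyEq (Filter.Eventually.of_forall fun t => ?_))
  have := pf_rank2 n A hA hdet (t • x) y
  simp only [Function.comp]
  have e1 : Matrix.of (mf A + t • mf (wdg x y))
      = A + (Matrix.vecMulVec (t • x) y - Matrix.vecMulVec y (t • x)) := by
    ext i j
    simp [wdg, mf, Matrix.vecMulVec_apply]; ring
  rw [pfF, e1, this, gg, smul_dotProduct, smul_eq_mul]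

theorem pf_hasDerivAt (n : ℕ) (a : ℝ → Matrix (Fin (2*n)) (Fin (2*n)) ℝ) (t : ℝ)
    (hA : (a t).transpose = -(a t)) (hdet : (a t).det ≠ 0) (x y z w : Fin (2*n) → ℝ) (c : ℝ)
    (ha : ∀ i j, HasDerivAt (fun t => a t i j) ((wdg x y + c • wdg z w) i j) t) :
    HasDerivAt (fun t => pfaffian n (a t))
      (-(gg (a t) x y + c * gg (a t) z w) * pfaffian n (a t)) t := by
  have hl : HasDerivAt (fun t : ℝ => mf (a t)) (mf (wdg x y) + c • mf (wdg z w)) t := by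
    rw [hasDerivAt_pi]; intro i
    rw [hasDerivAt_pi]; intro j
    exact ha i j
  have h1 := (pfF_diff n (mf (a t))).hasFDerivAt.comp_hasDerivAt t hl
  rw [map_add, map_smul, pf_fderiv n _ hA hdet, pf_fderiv n _ hA hdet] at h1
  have e : -(gg (a t) x y + c * gg (a t) z w) * pfaffian n (a t) =
    -gg (a t) x y * pfaffian n (a t) + c • (-gg (a t) z w * pfaffian n (a t)) := by
    simp; ring
  rw [e]
  exact h1

section
attribute [local instance] Matrix.linftyOpNormedRing Matrix.linftyOpNormedAlgebra

theorem inv_hasDerivAt {m : ℕ} (a : ℝ → Matrix (Fin m) (Fin m) ℝ) (t : ℝ)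
    (hdet : (a t).det ≠ 0) (X : Matrix (Fin m) (Fin m) ℝ)
    (ha : ∀ i j, HasDerivAt (fun t => a t i j) (X i j) t) (i j : Fin m) :
    HasDerivAt (fun t => (a t)⁻¹ i j) (-((a t)⁻¹ * X * (a t)⁻¹) i j) t := by
  have h1 : HasDerivAt a X t := by
    have h : HasDerivAt (fun t => ∑ i, ∑ j, a t i j • Matrix.single i j (1:ℝ))
        (∑ i, ∑ j, X i j • Matrix.single i j (1:ℝ)) t :=
      HasDerivAt.fun_sum fun i _ => HasDerivAt.fun_sum fun j _ => (ha i j).smul_const _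
    simpa [Matrix.smul_single, ← Matrix.matrix_eq_sum_single] using h
  let u : (Matrix (Fin m) (Fin m) ℝ)ˣ := Matrix.nonsingInvUnit (a t) (isUnit_iff_ne_zero.mpr hdet)
  have hu : (u : Matrix (Fin m) (Fin m) ℝ) = a t := rfl
  have h2 := hasFDerivAt_ringInverse (𝕜 := ℝ) u
  rw [hu] at h2
  have h3 := h2.comp_hasDerivAt t h1
  let L : Matrix (Fin m) (Fin m) ℝ →ₗ[ℝ] ℝ := 
    { toFun := fun M => M i j, map_add' := fun _ _ => rfl, map_smul' := fun _ _ => rfl }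
  have h4 := (LinearMap.toContinuousLinearMap L).hasFDerivAt.comp_hasDerivAt t h3
  have hui : ((u⁻¹ : (Matrix (Fin m) (Fin m) ℝ)ˣ) : Matrix (Fin m) (Fin m) ℝ) = (a t)⁻¹ := rfl
  have e1 : (fun t => (a t)⁻¹ i j) = ⇑(LinearMap.toContinuousLinearMap L) ∘ Ring.inverse ∘ a := by
    funext s
    simp [L, Matrix.nonsing_inv_eq_ringInverse]
    rfl
  have e2 : -((a t)⁻¹ * X * (a t)⁻¹) i j = (LinearMap.toContinuousLinearMap L)
      ((-((ContinuousLinearMap.mulLeftRight ℝ (Matrix (Fin m) (Fin m) ℝ)) ↑u⁻¹) ↑u⁻¹) X) := by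
    simp [L, hui]
    rfl
  rw [e1, e2]
  exact h4
end

open Matrix in
theorem gg_hasDerivAt {m : ℕ} (a : ℝ → Matrix (Fin m) (Fin m) ℝ) (t : ℝ)
    (hdet : (a t).det ≠ 0) (x y z w : Fin m → ℝ) (c : ℝ)
    (ha : ∀ i j, HasDerivAt (fun t => a t i j) ((wdg x y + c • wdg z w) i j) t)
    (u v : ℝ → Fin m → ℝ) (u' v' : Fin m → ℝ)
    (hu : ∀ i, HasDerivAt (fun t => u t i) (u' i) t)
    (hv : ∀ i, HasDerivAt (fun t => v t i) (v' i) t) :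
    HasDerivAt (fun t => gg (a t) (u t) (v t))
      (gg (a t) u' (v t) + gg (a t) (u t) v'
        - (gg (a t) (u t) x * gg (a t) y (v t) - gg (a t) (u t) y * gg (a t) x (v t))
        - c * (gg (a t) (u t) z * gg (a t) w (v t) - gg (a t) (u t) w * gg (a t) z (v t))) t := by
  have key : ∀ (B : Matrix (Fin m) (Fin m) ℝ) (x y u v : Fin m → ℝ), 
      u ⬝ᵥ (B * wdg x y * B) *ᵥ v = 
       (u ⬝ᵥ B *ᵥ x) * (y ⬝ᵥ B *ᵥ v) - (u ⬝ᵥ B *ᵥ y) * (x ⬝ᵥ B *ᵥ v) := by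
    intro B x y u v
    rw [wdg, mul_sub, sub_mul, mul_vecMulVec, mul_vecMulVec, vecMulVec_mul, vecMulVec_mul, sub_mulVec,
      dotProduct_sub, vecMulVec_mulVec, vecMulVec_mulVec]
    simp [dotProduct_mulVec]; ring
  have hX : u t ⬝ᵥ ((a t)⁻¹ * (wdg x y + c • wdg z w) * (a t)⁻¹) *ᵥ (v t) = 
      (gg (a t) (u t) x * gg (a t) y (v t) - gg (a t) (u t) y * gg (a t) x (v t))
        + c * (gg (a t) (u t) z * gg (a t) w (v t) - gg (a t) (u t) w * gg (a t) z (v t)) := by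
    rw [mul_add, add_mul, Matrix.mul_smul, Matrix.smul_mul, add_mulVec, smul_mulVec, dotProduct_add,
      dotProduct_smul, key, key]; rfl
  have hd : HasDerivAt (fun t => ∑ i, u t i * ∑ j, (a t)⁻¹ i j * v t j) 
     (∑ i, (u' i * (∑ j, (a t)⁻¹ i j * v t j) + u t i * 
       ∑ j, ((-((a t)⁻¹ * (wdg x y + c • wdg z w) * (a t)⁻¹) i j) * v t j + (a t)⁻¹ i j * v' j))) t :=
    HasDerivAt.fun_sum fun i _ => (hu i).mul (HasDerivAt.fun_sum fun j _ => 
      (inv_hasDerivAt a t hdet _ ha i j).mul (hv j))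
  refine HasDerivAt.congr_deriv hd ?_
  rw [sub_sub, ← hX]
  simp only [gg, dotProduct, mulVec, mul_add, Finset.sum_add_distrib, Finset.mul_sum, neg_mul,
    mul_neg, Finset.sum_neg_distrib]
  ring

theorem gg_add_right {m : ℕ} (A : Matrix (Fin m) (Fin m) ℝ) (x y z : Fin m → ℝ) :
    gg A x (y + z) = gg A x y + gg A x z := by
  simp [gg, Matrix.mulVec_add, dotProduct_add]

theorem gg_smul_right {m : ℕ} (A : Matrix (Fin m) (Fin m) ℝ) (c : ℝ) (x y : Fin m → ℝ) :
    gg A x (c • y) = c * gg A x y := by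
  simp [gg, Matrix.mulVec_smul, dotProduct_smul]

theorem gg_smul_left {m : ℕ} (A : Matrix (Fin m) (Fin m) ℝ) (c : ℝ) (x y : Fin m → ℝ) :
    gg A (c • x) y = c * gg A x y := by
  simp [gg, smul_dotProduct]

theorem deriv_step (F G G' : ℝ → ℝ) (P : ℝ → Prop) (s0 : ℝ) (hP : ∀ᶠ s in nhds s0, P s)
    (h : F =ᶠ[nhds s0] G) (hG : ∀ s, P s → HasDerivAt G (G' s) s) :
    deriv F =ᶠ[nhds s0] G' :=
  h.deriv.trans (hP.mono fun s hs => (hG s hs).deriv)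

theorem core (N : ℕ) (b : ℝ) (q d : Fin (2*N) → ℝ) (hd : ∀ i, d i * (q i - b) = 1)
    (φ : ℝ → ℝ → Fin (2*N) → ℝ)
    (hφs : ∀ s r i, HasDerivAt (fun t => φ t r i) (q i * φ s r i) s)
    (hφr : ∀ s r i, HasDerivAt (fun t => φ s t i) (q i ^ 3 * φ s r i) r)
    (a : ℝ → ℝ → Matrix (Fin (2*N)) (Fin (2*N)) ℝ)
    (hA : ∀ s r, (a s r).transpose = - a s r)
    (has : ∀ s r i j, HasDerivAt (fun t => a t r i j) ((q j - q i) * φ s r i * φ s r j) s)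
    (har : ∀ s r i j, HasDerivAt (fun t => a s t i j)
      ((q j - q i) * (q i ^ 2 - q i * q j + q j ^ 2) * φ s r i * φ s r j) r)
    (T T' : ℝ → ℝ → ℝ) (hT : ∀ s r, T s r = pfaffian N (a s r))
    (hT' : ∀ s r, T' s r = pfaffian N (Matrix.of fun i j => a s r i j +
      2 * b * (q j - q i) * d i * d j * φ s r i * φ s r j))
    (s r : ℝ) (hdet : (a s r).det ≠ 0) :
      (dS (dS (dS T')) s r * T s r
          - 3 * dS (dS T') s r * dS T s r
          + 3 * dS T' s r * dS (dS T) s r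
          - T' s r * dS (dS (dS T)) s r)
        - 3 * b * (dS (dS T') s r * T s r
          - 2 * dS T' s r * dS T s r
          + T' s r * dS (dS T) s r)
        + 3 * b^2 * (dS T' s r * T s r - T' s r * dS T s r)
        - (dR T' s r * T s r - T' s r * dR T s r) = 0 := by
  obtain ⟨X, hX⟩ : ∃ X : ℕ → ℝ → ℝ → Fin (2*N) → ℝ, X = fun k s r i => q i ^ k * φ s r i := ⟨_, rfl⟩
  obtain ⟨Y, hY⟩ : ∃ Y : ℝ → ℝ → Fin (2*N) → ℝ, Y = fun s r i => d i * φ s r i := ⟨_, rfl⟩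
  have hdq : ∀ i, d i * q i = 1 + b * d i := fun i => by linear_combination hd i
  have hXs : ∀ k s r i, HasDerivAt (fun t => X k t r i) (X (k+1) s r i) s := by
    intro k s r i
    simp only [hX]
    refine ((hφs s r i).const_mul (q i ^ k)).congr_deriv ?_
    ring
  have hXr : ∀ k s r i, HasDerivAt (fun t => X k s t i) (X (k+3) s r i) r := by
    intro k s r i
    simp only [hX]
    refine ((hφr s r i).const_mul (q i ^ k)).congr_deriv ?_
    ring
  have hYs : ∀ s r i, HasDerivAt (fun t => Y t r i) ((X 0 s r + b • Y s r) i) s := by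
    intro s r i
    simp only [hX, hY]
    refine ((hφs s r i).const_mul (d i)).congr_deriv ?_
    simp
    linear_combination (φ s r i) * hdq i
  have hYr : ∀ s r i, HasDerivAt (fun t => Y s t i)
      ((X 2 s r + b • X 1 s r + b^2 • X 0 s r + b^3 • Y s r) i) r := by
    intro s r i
    simp only [hX, hY]
    refine ((hφr s r i).const_mul (d i)).congr_deriv ?_
    simp
    linear_combination (φ s r i) * (q i ^ 2 + b * q i + b ^ 2) * hdq i
  have has' : ∀ s r i j, HasDerivAt (fun t => a t r i j)
      ((wdg (X 0 s r) (X 1 s r) + (0:ℝ) • wdg (X 0 s r) (X 0 s r)) i j) s := by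
    intro s r i j
    refine (has s r i j).congr_deriv ?_
    simp [hX, wdg, Matrix.vecMulVec_apply]; ring
  have har' : ∀ s r i j, HasDerivAt (fun t => a s t i j)
      ((wdg (X 0 s r) (X 3 s r) + (-2:ℝ) • wdg (X 1 s r) (X 2 s r)) i j) r := by
    intro s r i j
    refine (har s r i j).congr_deriv ?_
    simp [hX, wdg, Matrix.vecMulVec_apply]; ring
  have sk := fun s r => gg_skew (a s r) (hA s r)
  have sk0 : ∀ s r x, gg (a s r) x x = 0 := fun s r x => by linarith [sk s r x x]
  have hTT : ∀ s r, (a s r).det ≠ 0 → T' s r = T s r + 2 * b * (T s r * gg (a s r) (X 0 s r) (Y s r)) := by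
    intro s r h
    have := pf_rank2 N (a s r) (hA s r) h ((-2*b) • X 0 s r) (Y s r)
    have e : (Matrix.of fun i j => a s r i j + 2 * b * (q j - q i) * d i * d j * φ s r i * φ s r j)
       = a s r + (Matrix.vecMulVec ((-2*b) • X 0 s r) (Y s r) - Matrix.vecMulVec (Y s r) ((-2*b) • X 0 s r)) := by
      ext i j
      simp [hX, hY, Matrix.vecMulVec_apply]
      linear_combination (φ s r i) * (φ s r j) * (2 * b * d i * hdq j - 2 * b * d j * hdq i)
    rw [hT', e, this, hT]
    have := gg_smul_left (a s r) (-2*b) (X 0 s r) (Y s r)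
    rw [gg] at this
    rw [this]; ring
  have dT : ∀ s, (a s r).det ≠ 0 → HasDerivAt (fun s => T s r)
      (T s r * gg (a s r) (X 1 s r) (X 0 s r)) s := by
    intro s h
    simp only [hT]
    refine (pf_hasDerivAt N (fun t => a t r) s (hA s r) h _ _ _ _ _ (has' s r)).congr_deriv ?_
    rw [sk s r (X 1 s r) (X 0 s r)]; ring
  have dTr : HasDerivAt (fun r => T s r)
      (T s r * (gg (a s r) (X 3 s r) (X 0 s r) - 2 * gg (a s r) (X 2 s r) (X 1 s r))) r := by
    simp only [hT]
    refine (pf_hasDerivAt N (fun t => a s t) r (hA s r) hdet _ _ _ _ _ (har' s r)).congr_deriv ?_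
    rw [sk s r (X 3 s r) (X 0 s r), sk s r (X 2 s r) (X 1 s r)]; ring
  have dXX : ∀ j k s, (a s r).det ≠ 0 → HasDerivAt
      (fun s => T s r * gg (a s r) (X j s r) (X k s r))
      (T s r * (gg (a s r) (X 1 s r) (X 0 s r) * gg (a s r) (X j s r) (X k s r)
        + gg (a s r) (X (j+1) s r) (X k s r) + gg (a s r) (X j s r) (X (k+1) s r)
        - gg (a s r) (X j s r) (X 0 s r) * gg (a s r) (X 1 s r) (X k s r)
        + gg (a s r) (X j s r) (X 1 s r) * gg (a s r) (X 0 s r) (X k s r))) s := by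
    intro j k s h
    refine ((dT s h).mul (gg_hasDerivAt (fun t => a t r) s h _ _ _ _ _ (has' s r)
      (fun t => X j t r) (fun t => X k t r) _ _ (hXs j s r) (hXs k s r))).congr_deriv ?_
    ring
  have dXY : ∀ j s, (a s r).det ≠ 0 → HasDerivAt
      (fun s => T s r * gg (a s r) (X j s r) (Y s r))
      (T s r * (gg (a s r) (X 1 s r) (X 0 s r) * gg (a s r) (X j s r) (Y s r)
        + gg (a s r) (X (j+1) s r) (Y s r) + gg (a s r) (X j s r) (X 0 s r)
        + b * gg (a s r) (X j s r) (Y s r)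
        - gg (a s r) (X j s r) (X 0 s r) * gg (a s r) (X 1 s r) (Y s r)
        + gg (a s r) (X j s r) (X 1 s r) * gg (a s r) (X 0 s r) (Y s r))) s := by
    intro j s h
    refine ((dT s h).mul (gg_hasDerivAt (fun t => a t r) s h _ _ _ _ _ (has' s r)
      (fun t => X j t r) (fun t => Y t r) _ _ (hXs j s r) (hYs s r))).congr_deriv ?_
    rw [gg_add_right, gg_smul_right]
    ring
  have dY0r : HasDerivAt (fun r => T s r * gg (a s r) (X 0 s r) (Y s r)) _ r :=
    (dTr.mul (gg_hasDerivAt (fun t => a s t) r hdet _ _ _ _ _ (har' s r)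
      (fun t => X 0 s t) (fun t => Y s t) _ _ (hXr 0 s r) (hYr s r)))
  -- the functions
  have d20 : ∀ s, (a s r).det ≠ 0 → HasDerivAt
      (fun s => T s r * gg (a s r) (X 1 s r) (X 0 s r))
      (T s r * gg (a s r) (X 2 s r) (X 0 s r)) s := by
    intro s h
    refine (dXX 1 0 s h).congr_deriv ?_
    simp only [sk0, zero_add, Nat.reduceAdd]; ring
  have d30 : ∀ s, (a s r).det ≠ 0 → HasDerivAt
      (fun s => T s r * gg (a s r) (X 2 s r) (X 0 s r))
      (T s r * (gg (a s r) (X 3 s r) (X 0 s r) + gg (a s r) (X 2 s r) (X 1 s r))) s := by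
    intro s h
    refine (dXX 2 0 s h).congr_deriv ?_
    simp only [sk0, zero_add, Nat.reduceAdd]; ring
  have e0 : ∀ s, (a s r).det ≠ 0 → HasDerivAt
      (fun s => T s r * gg (a s r) (X 0 s r) (Y s r))
      (T s r * gg (a s r) (X 1 s r) (Y s r) + b * (T s r * gg (a s r) (X 0 s r) (Y s r))) s := by
    intro s h
    refine (dXY 0 s h).congr_deriv ?_
    simp only [sk0, zero_add, Nat.reduceAdd]
    rw [sk s r (X 0 s r) (X 1 s r)]; ring
  have e1 : ∀ s, (a s r).det ≠ 0 → HasDerivAt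
      (fun s => T s r * gg (a s r) (X 1 s r) (Y s r))
      (T s r * gg (a s r) (X 2 s r) (Y s r) + T s r * gg (a s r) (X 1 s r) (X 0 s r)
       + b * (T s r * gg (a s r) (X 1 s r) (Y s r))) s := by
    intro s h
    refine (dXY 1 s h).congr_deriv ?_
    simp only [sk0, zero_add, Nat.reduceAdd]; ring
  have e2 := dXY 2
  have hev : ∀ᶠ t in nhds s, (a t r).det ≠ 0 := by
    have hc : ContinuousAt (fun t => (a t r).det) s := by
      have : ∀ t, (a t r).det = ∑ σ : Equiv.Perm (Fin (2*N)), ((Equiv.Perm.sign σ : ℤ) : ℝ) *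
          ∏ i, a t r (σ i) i := fun t => Matrix.det_apply' _
      simp_rw [this]
      refine tendsto_finsetSum _ fun σ _ => continuousAt_const.mul
        (tendsto_finsetProd _ fun i _ => (has s r _ _).continuousAt)
    exact hc.eventually_ne hdet
  have hevr : ∀ᶠ t in nhds r, (a s t).det ≠ 0 := by
    have hc : ContinuousAt (fun t => (a s t).det) r := by
      have : ∀ t, (a s t).det = ∑ σ : Equiv.Perm (Fin (2*N)), ((Equiv.Perm.sign σ : ℤ) : ℝ) *
          ∏ i, a s t (σ i) i := fun t => Matrix.det_apply' _
      simp_rw [this]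
      refine tendsto_finsetSum _ fun σ _ => continuousAt_const.mul
        (tendsto_finsetProd _ fun i _ => (har s r _ _).continuousAt)
    exact hc.eventually_ne hdet
  have T1 := deriv_step _ _ _ _ s hev (Filter.EventuallyEq.refl _ _) dT
  have T2 := deriv_step _ _ _ _ s hev T1 d20
  have T3 := deriv_step _ _ _ _ s hev T2 d30
  have S0 : (fun t => T' t r) =ᶠ[nhds s]
     (fun t => T t r + 2 * b * (T t r * gg (a t r) (X 0 t r) (Y t r))) := hev.mono fun t ht => hTT t r ht
  have S1 := deriv_step _ _ _ _ s hev S0 (fun t ht => (dT t ht).add ((e0 t ht).const_mul (2*b)))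
  have S2 := deriv_step _ _ _ _ s hev S1 (fun t ht =>
    (d20 t ht).add (((e1 t ht).add ((e0 t ht).const_mul b)).const_mul (2*b)))
  have S3 := deriv_step _ _ _ _ s hev S2 (fun t ht =>
    (d30 t ht).add (((((e2 t ht).add (d20 t ht)).add ((e1 t ht).const_mul b)).add
     (((e1 t ht).add ((e0 t ht).const_mul b)).const_mul b)).const_mul (2*b)))
  have R0 : (fun t => T' s t) =ᶠ[nhds r]
     (fun t => T s t + 2 * b * (T s t * gg (a s t) (X 0 s t) (Y s t))) := hevr.mono fun t ht => hTT s t ht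
  have R1 := ((dTr.add (dY0r.const_mul (2*b))).congr_of_eventuallyEq R0).deriv
  have t1 : dS T s r = _ := T1.self_of_nhds
  have t2 : dS (dS T) s r = _ := T2.self_of_nhds
  have t3 : dS (dS (dS T)) s r = _ := T3.self_of_nhds
  have s0 : T' s r = _ := S0.self_of_nhds
  have s1 : dS T' s r = _ := S1.self_of_nhds
  have s2 : dS (dS T') s r = _ := S2.self_of_nhds
  have s3 : dS (dS (dS T')) s r = _ := S3.self_of_nhds
  have tr : dR T s r = _ := dTr.deriv
  have sr : dR T' s r = _ := R1
  rw [t1, t2, t3, s0, s1, s2, s3, tr, sr]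
  simp only [sk0, zero_add, Nat.reduceAdd, gg_add_right, gg_smul_right]
  rw [sk s r (X 0 s r) (X 1 s r), sk s r (X 0 s r) (X 2 s r), sk s r (X 0 s r) (X 3 s r)]
  ring

theorem dS_smooth (F : ℝ → ℝ → ℝ → ℝ)
    (hF : ContDiff ℝ (⊤ : ℕ∞) (fun z : ℝ × ℝ × ℝ => F z.1 z.2.1 z.2.2)) :
    ContDiff ℝ (⊤ : ℕ∞) (fun z : ℝ × ℝ × ℝ => dS (F z.1) z.2.1 z.2.2) := by
  have h := ContDiff.fderiv_apply (𝕜 := ℝ) (m := ((⊤ : ℕ∞) : WithTop ℕ∞)) (n := ((⊤ : ℕ∞) : WithTop ℕ∞))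
    (f := fun (z : ℝ × ℝ × ℝ) (t : ℝ) => F z.1 t z.2.2) (g := fun z => z.2.1) (k := fun _ => (1:ℝ))
    (hF.comp (g := fun z : ℝ × ℝ × ℝ => F z.1 z.2.1 z.2.2)
      (f := fun w : (ℝ × ℝ × ℝ) × ℝ => (w.1.1, w.2, w.1.2.2)) (by fun_prop))
    (by fun_prop) (by fun_prop) (by simp)
  exact h

theorem dR_smooth (F : ℝ → ℝ → ℝ → ℝ)
    (hF : ContDiff ℝ (⊤ : ℕ∞) (fun z : ℝ × ℝ × ℝ => F z.1 z.2.1 z.2.2)) :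
    ContDiff ℝ (⊤ : ℕ∞) (fun z : ℝ × ℝ × ℝ => dR (F z.1) z.2.1 z.2.2) := by
  have h := ContDiff.fderiv_apply (𝕜 := ℝ) (m := ((⊤ : ℕ∞) : WithTop ℕ∞)) (n := ((⊤ : ℕ∞) : WithTop ℕ∞))
    (f := fun (z : ℝ × ℝ × ℝ) (t : ℝ) => F z.1 z.2.1 t) (g := fun z => z.2.2) (k := fun _ => (1:ℝ))
    (hF.comp (g := fun z : ℝ × ℝ × ℝ => F z.1 z.2.1 z.2.2)
      (f := fun w : (ℝ × ℝ × ℝ) × ℝ => (w.1.1, w.1.2.1, w.2)) (by fun_prop))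
    (by fun_prop) (by fun_prop) (by simp)
  exact h

theorem smooth_cont (F : ℝ → ℝ → ℝ → ℝ)
    (hF : ContDiff ℝ (⊤ : ℕ∞) (fun z : ℝ × ℝ × ℝ => F z.1 z.2.1 z.2.2)) (s r : ℝ) :
    Continuous (fun e => F e s r) :=
  hF.continuous.comp (f := fun e : ℝ => (e, s, r)) (by fun_prop)

theorem exists_skew (N : ℕ) : ∃ J : Matrix (Fin (2*N)) (Fin (2*N)) ℝ,
    J.transpose = -J ∧ IsUnit J.det := by
  let e : Fin N ⊕ Fin N ≃ Fin (2*N) := finSumFinEquiv.trans (finCongr (two_mul N).symm)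
  refine ⟨Matrix.reindex e e (Matrix.J (Fin N) ℝ), ?_, ?_⟩
  · rw [Matrix.transpose_reindex, Matrix.J_transpose]; rfl
  · rw [Matrix.det_reindex_self]; exact Matrix.isUnit_det_J _ _

theorem eventually_det {m : ℕ} (A J : Matrix (Fin m) (Fin m) ℝ) (hJ : IsUnit J.det) :
    ∀ᶠ e in nhdsWithin (0:ℝ) {0}ᶜ, (A + e • J).det ≠ 0 := by
  have h1 : ∀ e : ℝ, (A + e • J).det = J.det * ((-(J⁻¹ * A)).charpoly.eval e) := by
    intro e
    rw [Matrix.eval_charpoly, ← Matrix.det_mul]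
    congr 1
    rw [sub_neg_eq_add, mul_add, Matrix.mul_nonsing_inv_cancel_left _ _ hJ, add_comm]
    congr 1
    rw [Matrix.scalar_apply, ← Matrix.smul_one_eq_diagonal, Matrix.mul_smul, mul_one]
  have hfin : {e : ℝ | (-(J⁻¹ * A)).charpoly.IsRoot e}.Finite :=
    Polynomial.finite_setOf_isRoot (Matrix.charpoly_monic _).ne_zero
  have h2 := (hfin.subset (Set.diff_subset (t := {0}))).isClosed.isOpen_compl.mem_nhds
    (x := (0:ℝ)) (by simp)
  filter_upwards [mem_nhdsWithin_of_mem_nhds h2, self_mem_nhdsWithin] with e he he0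
  rw [h1]
  refine mul_ne_zero hJ.ne_zero fun h => he ⟨h, he0⟩

/-- Lemma 3.1: `((D_s - b)³ - (D_r - b³)) τ_{l+1}·τ_l = 0`, i.e.
`D_s³ τ_{l+1}·τ_l - 3b D_s² τ_{l+1}·τ_l + 3b² D_s τ_{l+1}·τ_l - D_r τ_{l+1}·τ_l = 0`. -/
theorem stmt13
    (N : ℕ) (hN : 1 ≤ N) (b : ℝ) (hb : b ≠ 0)
    (p : Fin (2*N) → ℝ) (hp0 : ∀ i, p i ≠ 0)
    (hpsum : ∀ i j, p i + p j ≠ 0)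
    (hbm : ∀ i, 1 - b * p i ≠ 0) (hbp : ∀ i, 1 + b * p i ≠ 0)
    (ξ : Fin (2*N) → ℝ)
    (cc : Matrix (Fin (2*N)) (Fin (2*N)) ℝ) (hcc : ∀ i j, cc i j = -cc j i)
    (φ : Fin (2*N) → ℤ → ℝ → ℝ → ℝ)
    (hφ : ∀ i l s r, φ i l s r =
      ((1 + b * p i) / (1 - b * p i)) ^ l * Real.exp (s / p i + r / (p i)^3 + ξ i))
    (τ : ℤ → ℝ → ℝ → ℝ)
    (hτ : ∀ l s r, τ l s r = pfaffian N (Matrix.of fun i j =>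
      cc i j + ((p i - p j) / (p i + p j)) * φ i l s r * φ j l s r)) :
    ∀ (l : ℤ) (s r : ℝ),
      (dS (dS (dS (τ (l+1)))) s r * τ l s r
          - 3 * dS (dS (τ (l+1))) s r * dS (τ l) s r
          + 3 * dS (τ (l+1)) s r * dS (dS (τ l)) s r
          - τ (l+1) s r * dS (dS (dS (τ l))) s r)
        - 3 * b * (dS (dS (τ (l+1))) s r * τ l s r
          - 2 * dS (τ (l+1)) s r * dS (τ l) s r
          + τ (l+1) s r * dS (dS (τ l)) s r)
        + 3 * b^2 * (dS (τ (l+1)) s r * τ l s r - τ (l+1) s r * dS (τ l) s r)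
        - (dR (τ (l+1)) s r * τ l s r - τ (l+1) s r * dR (τ l) s r) = 0 := by
  intro l s r
  obtain ⟨J, hJs, hJd⟩ := exists_skew N
  have hJs' : ∀ i j, J i j = - J j i := fun i j => by
    have := congrFun (congrFun hJs j) i
    simpa using this
  -- matrices
  obtain ⟨a, ha⟩ : ∃ a : ℤ → ℝ → ℝ → ℝ → Matrix (Fin (2*N)) (Fin (2*N)) ℝ,
      a = fun l e s r => Matrix.of fun i j =>
      cc i j + e * J i j + ((p i - p j) / (p i + p j)) * φ i l s r * φ j l s r := ⟨_, rfl⟩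
  obtain ⟨F, hF⟩ : ∃ F : ℤ → ℝ → ℝ → ℝ → ℝ, F = fun l e s r => pfaffian N (a l e s r) := ⟨_, rfl⟩
  have hF0 : ∀ l, τ l = F l 0 := by
    intro l; funext s r
    rw [hτ, hF, ha]; simp
  have hFs : ∀ l, ContDiff ℝ (⊤ : ℕ∞) (fun z : ℝ × ℝ × ℝ => F l z.1 z.2.1 z.2.2) := by
    intro l
    simp only [hF]
    apply pf_smooth
    intro i j
    simp only [ha, Matrix.of_apply, hφ, div_eq_mul_inv _ (p _), div_eq_mul_inv _ ((p _)^3)]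
    fun_prop
  have S1 := fun l => dS_smooth (F l) (hFs l)
  have S2 := fun l => dS_smooth (fun e => dS (F l e)) (S1 l)
  have S3 := fun l => dS_smooth (fun e => dS (dS (F l e))) (S2 l)
  have R1 := fun l => dR_smooth (F l) (hFs l)
  have c0 := fun l => smooth_cont (F l) (hFs l) s r
  have c1 := fun l => smooth_cont (fun e => dS (F l e)) (S1 l) s r
  have c2 := fun l => smooth_cont (fun e => dS (dS (F l e))) (S2 l) s r
  have c3 := fun l => smooth_cont (fun e => dS (dS (dS (F l e)))) (S3 l) s r
  have cr := fun l => smooth_cont (fun e => dR (F l e)) (R1 l) s r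
  have hev : ∀ᶠ e in nhdsWithin (0:ℝ) {0}ᶜ, (a l e s r).det ≠ 0 := by
    filter_upwards [eventually_det (a l 0 s r) J hJd] with e he
    have : a l e s r = a l 0 s r + e • J := by
      ext i j; simp [ha]; ring
    rwa [this]
  rw [hF0, hF0]
  let Φ : ℝ → ℝ := fun e =>
      (dS (dS (dS (F (l+1) e))) s r * F l e s r
          - 3 * dS (dS (F (l+1) e)) s r * dS (F l e) s r
          + 3 * dS (F (l+1) e) s r * dS (dS (F l e)) s r
          - F (l+1) e s r * dS (dS (dS (F l e))) s r)
        - 3 * b * (dS (dS (F (l+1) e)) s r * F l e s r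
          - 2 * dS (F (l+1) e) s r * dS (F l e) s r
          + F (l+1) e s r * dS (dS (F l e)) s r)
        + 3 * b^2 * (dS (F (l+1) e) s r * F l e s r - F (l+1) e s r * dS (F l e) s r)
        - (dR (F (l+1) e) s r * F l e s r - F (l+1) e s r * dR (F l e) s r)
  change Φ 0 = 0
  have hc : Continuous Φ := by
    have a0 := c0 l
    have a1 := c1 l
    have a2 := c2 l
    have a3 := c3 l
    have ar := cr l
    have b0 := c0 (l+1)
    have b1 := c1 (l+1)
    have b2 := c2 (l+1)
    have b3 := c3 (l+1)
    have br := cr (l+1)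
    simp only [Φ]
    fun_prop
  have hz : ∀ᶠ e in nhdsWithin (0:ℝ) {0}ᶜ, Φ e = 0 := by
    filter_upwards [hev] with e he
    have hs : ∀ s r i, HasDerivAt (fun t => φ i l t r) ((p i)⁻¹ * φ i l s r) s := by
      intro s r i
      simp only [hφ]
      have h1 : HasDerivAt (fun t : ℝ => t / p i + r / (p i)^3 + ξ i) (1 / p i) s :=
        (((hasDerivAt_id s).div_const (p i)).add_const _).add_const _
      refine (h1.exp.const_mul _).congr_deriv ?_
      ring
    have hr : ∀ s r i, HasDerivAt (fun t => φ i l s t) ((p i)⁻¹ ^ 3 * φ i l s r) r := by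
      intro s r i
      simp only [hφ]
      have h1 : HasDerivAt (fun t : ℝ => s / p i + t / (p i)^3 + ξ i) (1 / (p i)^3) r :=
        (((hasDerivAt_id r).div_const ((p i)^3)).const_add _).add_const _
      refine (h1.exp.const_mul _).congr_deriv ?_
      ring
    have hpp : ∀ i j, (p i - p j) / (p i + p j) * ((p i)⁻¹ + (p j)⁻¹) = (p j)⁻¹ - (p i)⁻¹ := by
      intro i j
      have := hp0 i
      have := hp0 j
      have := hpsum i j
      field_simp
      ring
    refine core N b (fun i => (p i)⁻¹) (fun i => p i / (1 - b * p i)) ?_ (fun s r i => φ i l s r)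
      hs hr (a l e) ?_ ?_ ?_ (F l e) (F (l+1) e) ?_ ?_ s r he
    · intro i
      have := hp0 i
      have h3 : 1 - p i * b ≠ 0 := by rw [mul_comm]; exact hbm i
      field_simp
    · intro s r
      ext i j
      simp only [ha, Matrix.transpose_apply, Matrix.neg_apply, Matrix.of_apply]
      rw [hcc j i, hJs' j i, add_comm (p j) (p i)]
      ring
    · intro s r i j
      simp only [ha, Matrix.of_apply]
      refine ((((hs s r i).const_mul ((p i - p j) / (p i + p j))).mul (hs s r j)).const_add
        (cc i j + e * J i j)).congr_deriv ?_
      linear_combination φ i l s r * φ j l s r * hpp i j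
    · intro s r i j
      simp only [ha, Matrix.of_apply]
      refine ((((hr s r i).const_mul ((p i - p j) / (p i + p j))).mul (hr s r j)).const_add
        (cc i j + e * J i j)).congr_deriv ?_
      linear_combination φ i l s r * φ j l s r *
        ((p i)⁻¹^2 - (p i)⁻¹ * (p j)⁻¹ + (p j)⁻¹^2) * hpp i j
    · intro s r; rw [hF]
    · intro s r
      simp only [hF]
      refine congrArg (pfaffian N) ?_
      ext i j
      have hstep : ∀ i, φ i (l+1) s r = (1 + b * p i) / (1 - b * p i) * φ i l s r := by
        intro i
        rw [hφ, hφ, zpow_add_one₀ (div_ne_zero (hbp i) (hbm i))]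
        ring
      simp only [ha, Matrix.of_apply, hstep]
      have k : (p i - p j) / (p i + p j) * ((1 + b * p i) / (1 - b * p i)) *
          ((1 + b * p j) / (1 - b * p j)) = (p i - p j) / (p i + p j) +
          2 * b * ((p j)⁻¹ - (p i)⁻¹) * (p i / (1 - b * p i)) * (p j / (1 - b * p j)) := by
        have := hp0 i
        have := hp0 j
        have := hpsum i j
        have h3 : 1 - p i * b ≠ 0 := by rw [mul_comm]; exact hbm i
        have h4 : 1 - p j * b ≠ 0 := by rw [mul_comm]; exact hbm j
        have h5 := hbm i
        have h6 := hbm j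
        field_simp
        ring
      linear_combination φ i l s r * φ j l s r * k
  have t1 : Filter.Tendsto Φ (nhdsWithin (0:ℝ) {0}ᶜ) (nhds (Φ 0)) :=
    hc.continuousAt.mono_left nhdsWithin_le_nhds
  have t2 : Filter.Tendsto Φ (nhdsWithin (0:ℝ) {0}ᶜ) (nhds 0) :=
    tendsto_const_nhds.congr' (hz.mono fun e he => he.symm)
  exact tendsto_nhds_unique t1 t2
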